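/- Let μ₁, μ₂ : X × 𝒵 → [0,1] be two reward models and define, for sequences x = (x₁,…,x_q) in X and z = (z₁,…,z_q) in 𝒵, the balanced mixture moment 𝐌(x,z) := ½ Π_{i=1}^q μ₁(x_i, z_i) + ½ Π_{i=1}^q μ₂(x_i, z_i). Then for any length-three sequences x = (x₁,x₂,x₃) and z = (z₁,z₂,z₃): 𝐌(x,z) = −2·𝐌(x_{\{1\}},z_{\{1\}})·𝐌(x_{\{2\}},z_{\{2\}})·𝐌(x_{\{3\}},z_{\{3\}}) + 𝐌(x_{\{1\}},z_{\{1\}})·𝐌(x_{\{2,3\}},z_{\{2,3\}}) + 𝐌(x_{\{2\}},z_{\{2\}})·𝐌(x_{\{1,3\}},z_{\{1,3\}}) + 𝐌(x_{\{3\}},z_{\{3\}})·𝐌(x_{\{1,2\}},z_{\{1,2\}}). -/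

import Mathlib

open Finset

/-- The balanced two-component mixture moment
`𝐌(x_I, z_I) = ½ Π_{i∈I} μ₁(x_i, z_i) + ½ Π_{i∈I} μ₂(x_i, z_i)`. -/
noncomputable def balMoment {X Z : Type*} (μ₁ μ₂ : X → Z → ℝ) {d : ℕ}
    (x : Fin d → X) (z : Fin d → Z) (I : Finset (Fin d)) : ℝ :=
  (1 / 2) * ∏ i ∈ I, μ₁ (x i) (z i) + (1 / 2) * ∏ i ∈ I, μ₂ (x i) (z i)

/-- Lemma: third moment of a balanced two-mixture from lower moments.
For a balanced mixture of two reward models, the degree-three moment is determined by the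
first- and second-order moments. -/
theorem statement2 {X Z : Type*} (μ₁ μ₂ : X → Z → ℝ)
    (hμ₁ : ∀ x z, μ₁ x z ∈ Set.Icc (0 : ℝ) 1)
    (hμ₂ : ∀ x z, μ₂ x z ∈ Set.Icc (0 : ℝ) 1)
    (x : Fin 3 → X) (z : Fin 3 → Z) :
    balMoment μ₁ μ₂ x z {0, 1, 2} =
      -2 * balMoment μ₁ μ₂ x z {0} * balMoment μ₁ μ₂ x z {1} * balMoment μ₁ μ₂ x z {2}
        + balMoment μ₁ μ₂ x z {0} * balMoment μ₁ μ₂ x z {1, 2}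
        + balMoment μ₁ μ₂ x z {1} * balMoment μ₁ μ₂ x z {0, 2}
        + balMoment μ₁ μ₂ x z {2} * balMoment μ₁ μ₂ x z {0, 1} := by
  have h₀₁ : (0 : Fin 3) ≠ 1 := by decide
  have h₀₂ : (0 : Fin 3) ≠ 2 := by decide
  have h₁₂ : (1 : Fin 3) ≠ 2 := by decide
  have h₀ : (0 : Fin 3) ∉ ({1, 2} : Finset (Fin 3)) := by decide
  simp only [balMoment, prod_insert h₀, prod_pair h₀₁, prod_pair h₀₂, prod_pair h₁₂,
    prod_singleton]
  ring
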